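/- For the DRB game on the k-dimensional grid, there exists n0 ∈ ℕ (depending only on k and the granularity γ) such that for all n ≥ n0: no non-uniform strategy profile is a Nash equilibrium; that is, if a profile r satisfies r_u ≠ r_v for some nodes u, v, then some node can strictly increase its payoff by unilaterally deviating. -/

import Mathlib

open Finset

noncomputable section

namespace DRB

/-- Nodes of the `k`-dimensional grid (torus) with side length `n`. -/
abbrev Node (n k : ℕ) := Fin k → Fin n

/-- Grid (Manhattan) distance on the torus:
`d_M(u,v) = Σ_i min(|u_i - v_i|, n - |u_i - v_i|)`. -/
def dM (n k : ℕ) (u v : Node n k) : ℕ :=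
  ∑ i, min ((u i : ℤ) - (v i : ℤ)).natAbs (n - ((u i : ℤ) - (v i : ℤ)).natAbs)

/-- All nodes different from `u`. -/
def others (n k : ℕ) (u : Node n k) : Finset (Node n k) :=
  Finset.univ.filter (fun v => v ≠ u)

/-- Normalization constant `c(s) = Σ_{v ≠ u} d_M(u,v)^{-s}` for node `u`. -/
def cnorm (n k : ℕ) (u : Node n k) (s : ℝ) : ℝ :=
  ∑ v ∈ others n k u, (dM n k u v : ℝ) ^ (-s)

/-- Long-range link probability `p_u(v, s) = d_M(u,v)^{-s} / c(s)`. -/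
def linkProb (n k : ℕ) (u v : Node n k) (s : ℝ) : ℝ :=
  (dM n k u v : ℝ) ^ (-s) / cnorm n k u s

/-- Link distance `D(s) = Σ_{v ≠ u} p_u(v,s) · d_M(u,v)` of node `u`. -/
def linkDist (n k : ℕ) (u : Node n k) (s : ℝ) : ℝ :=
  ∑ v ∈ others n k u, linkProb n k u v s * (dM n k u v : ℝ)

/-- Reciprocity `P_u(r) = Σ_{v ≠ u} p_u(v, r_u) · p_v(u, r_v)`. -/
def recip (n k : ℕ) (r : Node n k → ℝ) (u : Node n k) : ℝ :=
  ∑ v ∈ others n k u, linkProb n k u v (r u) * linkProb n k v u (r v)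

/-- DRB payoff `π_u(r) = D(r_u) · P_u(r)`. -/
def payoff (n k : ℕ) (r : Node n k → ℝ) (u : Node n k) : ℝ :=
  linkDist n k u (r u) * recip n k r u

/-- Membership in the strategy set `Σ = {0, γ, 2γ, 3γ, ...}`. -/
def InSigma (γ s : ℝ) : Prop := ∃ m : ℕ, s = m * γ

/-- A valid strategy profile (every coordinate lies in `Σ`). -/
def ValidProfile (n k : ℕ) (γ : ℝ) (r : Node n k → ℝ) : Prop :=
  ∀ u, InSigma γ (r u)

/-- Nash equilibrium of the DRB game with strategy set `Σ` of granularity `γ`. -/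
def IsNash (n k : ℕ) (γ : ℝ) (r : Node n k → ℝ) : Prop :=
  ∀ u : Node n k, ∀ s : ℝ, InSigma γ s →
    payoff n k r u ≥ payoff n k (Function.update r u s) u

/-- Strict Nash equilibrium. -/
def IsStrictNash (n k : ℕ) (γ : ℝ) (r : Node n k → ℝ) : Prop :=
  ∀ u : Node n k, ∀ s : ℝ, InSigma γ s → s ≠ r u →
    payoff n k r u > payoff n k (Function.update r u s) u

/-- `t`-strong Nash equilibrium: no coalition of size ≤ `t` has a weakly
improving joint deviation that strictly improves some member. -/
def IsTStrongNash (n k : ℕ) (γ : ℝ) (t : ℕ) (r : Node n k → ℝ) : Prop :=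
  ¬ ∃ (C : Finset (Node n k)) (s : Node n k → ℝ),
      C.Nonempty ∧ C.card ≤ t ∧ (∀ u ∈ C, InSigma γ (s u)) ∧
      (∀ u ∈ C,
        payoff n k (fun v => if v ∈ C then s v else r v) u ≥ payoff n k r u) ∧
      (∃ u ∈ C,
        payoff n k (fun v => if v ∈ C then s v else r v) u > payoff n k r u)

/-- Strong Nash equilibrium: coalitions of any size. -/
def IsStrongNash (n k : ℕ) (γ : ℝ) (r : Node n k → ℝ) : Prop :=
  ¬ ∃ (C : Finset (Node n k)) (s : Node n k → ℝ),
      C.Nonempty ∧ (∀ u ∈ C, InSigma γ (s u)) ∧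
      (∀ u ∈ C,
        payoff n k (fun v => if v ∈ C then s v else r v) u ≥ payoff n k r u) ∧
      (∃ u ∈ C,
        payoff n k (fun v => if v ∈ C then s v else r v) u > payoff n k r u)

/-- `b_u(j)`: the number of nodes at grid distance exactly `j` from `u`. -/
def countAt (n k : ℕ) (u : Node n k) (j : ℕ) : ℕ :=
  (Finset.univ.filter (fun v => v ≠ u ∧ dM n k u v = j)).card

/-- One asynchronous best-response step: a single node switches to a best
response to the current profile, all other strategies unchanged. -/
def BRStep (n k : ℕ) (γ : ℝ) (r r' : Node n k → ℝ) : Prop :=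
  ∃ (u : Node n k) (s : ℝ), InSigma γ s ∧
    (∀ t : ℝ, InSigma γ t →
      payoff n k (Function.update r u s) u ≥ payoff n k (Function.update r u t) u) ∧
    r' = Function.update r u s

/-- One synchronous best-response step: every node simultaneously switches
to a best response to the current profile `r`. -/
def SyncStep (n k : ℕ) (γ : ℝ) (r r' : Node n k → ℝ) : Prop :=
  ∀ u : Node n k, InSigma γ (r' u) ∧
    ∀ t : ℝ, InSigma γ t →
      payoff n k (Function.update r u (r' u)) u ≥
        payoff n k (Function.update r u t) u

end DRB


namespace DRB

/-- One-coordinate torus distance. -/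
def cd (n : ℕ) (a b : Fin n) : ℕ :=
  min ((a : ℤ) - (b : ℤ)).natAbs (n - ((a : ℤ) - (b : ℤ)).natAbs)

lemma dM_eq (n k : ℕ) (u v : Node n k) : dM n k u v = ∑ i, cd n (u i) (v i) := rfl

lemma cd_comm (n : ℕ) (a b : Fin n) : cd n a b = cd n b a := by
  unfold cd
  rw [← Int.natAbs_neg, neg_sub]

lemma dM_comm (n k : ℕ) (u v : Node n k) : dM n k u v = dM n k v u := by
  simp only [dM_eq]
  exact Finset.sum_congr rfl fun i _ => cd_comm n _ _

lemma cd_le (n : ℕ) (a b : Fin n) : cd n a b ≤ n := by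
  unfold cd; omega

lemma cd_pos (n : ℕ) (a b : Fin n) (h : a ≠ b) : 1 ≤ cd n a b := by
  have h1 := a.2
  have h2 := b.2
  have h3 : (a : ℕ) ≠ b := fun h' => h (Fin.ext h')
  unfold cd; omega

lemma dM_le (n k : ℕ) (u v : Node n k) : dM n k u v ≤ k * n := by
  rw [dM_eq]
  calc _ ≤ ∑ i : Fin k, n := Finset.sum_le_sum fun i _ => cd_le n _ _
    _ = k * n := by simp

lemma cd_le_dM (n k : ℕ) (u v : Node n k) (i : Fin k) : cd n (u i) (v i) ≤ dM n k u v := by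
  rw [dM_eq]
  exact Finset.single_le_sum (f := fun i => cd n (u i) (v i)) (fun _ _ => Nat.zero_le _) (Finset.mem_univ i)

lemma dM_pos (n k : ℕ) (u v : Node n k) (h : v ≠ u) : 1 ≤ dM n k u v := by
  obtain ⟨i, hi⟩ := Function.ne_iff.mp h
  exact (cd_pos n _ _ hi.symm).trans (cd_le_dM n k u v i)

lemma mem_others (n k : ℕ) (u v : Node n k) : v ∈ others n k u ↔ v ≠ u := by
  simp [others]

lemma dM_posR {n k : ℕ} {u v : Node n k} (h : v ∈ others n k u) : (1 : ℝ) ≤ dM n k u v := by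
  exact_mod_cast dM_pos n k u v ((mem_others n k u v).1 h)

lemma dM_leR (n k : ℕ) (u v : Node n k) : (dM n k u v : ℝ) ≤ k * n := by
  exact_mod_cast dM_le n k u v

lemma card_others (n k : ℕ) (u : Node n k) : ((others n k u).card : ℝ) = (n : ℝ) ^ k - 1 := by
  have : others n k u = Finset.univ.erase u := by
    ext v; simp [others]
  rw [this, Finset.card_erase_of_mem (Finset.mem_univ _), Finset.card_univ]
  have hp : 1 ≤ Fintype.card (Node n k) := Fintype.card_pos_iff.mpr ⟨u⟩
  rw [Nat.cast_sub hp]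
  simp

lemma card_ge (n k : ℕ) (hk : 1 ≤ k) (hn : 2 ≤ n) (u : Node n k) :
    (n : ℝ) ^ k / 2 ≤ (others n k u).card := by
  rw [card_others]
  have h2 : (2 : ℝ) ≤ n := by exact_mod_cast hn
  have : (2 : ℝ) ≤ (n : ℝ) ^ k := h2.trans (le_self_pow₀ (by linarith) (by omega))
  linarith

/-- Coordinate sum bound. -/
lemma coord_sum (n : ℕ) (a : Fin n) :
    ∑ b : Fin n, (1 : ℝ) / (max 1 (cd n a b) : ℕ) ≤ 4 * (2 + Real.log n) := by
  have key : ∀ b : Fin n, (1 : ℝ) / (max 1 (cd n a b) : ℕ) =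
      ∑ m ∈ Finset.range (n + 1), if cd n a b = m then (1 : ℝ) / (max 1 m : ℕ) else 0 := by
    intro b
    rw [Finset.sum_ite_eq, if_pos]
    exact Finset.mem_range.2 (Nat.lt_succ_of_le (cd_le n a b))
  rw [Finset.sum_congr rfl fun b _ => key b, Finset.sum_comm]
  have fib : ∀ m : ℕ, (∑ b : Fin n, if cd n a b = m then (1 : ℝ) / (max 1 m : ℕ) else 0) ≤
      4 * ((1 : ℝ) / (max 1 m : ℕ)) := by
    intro m
    rw [← Finset.sum_filter, Finset.sum_const, nsmul_eq_mul]
    apply mul_le_mul_of_nonneg_right _ (by positivity)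
    have : ((Finset.univ.filter fun b : Fin n => cd n a b = m).image
        (fun b : Fin n => (b : ℤ))) ⊆
        {(a : ℤ) - m, (a : ℤ) + m, (a : ℤ) + n - m, (a : ℤ) - n + m} := by
      intro z hz
      simp only [Finset.mem_image, Finset.mem_filter, Finset.mem_univ, true_and] at hz
      obtain ⟨b, hb, rfl⟩ := hz
      simp only [Finset.mem_insert, Finset.mem_singleton]
      have h1 := a.2
      have h2 := b.2
      unfold cd at hb; omega
    have h3 := Finset.card_le_card this
    rw [Finset.card_image_of_injective _ (by
      intro x y hxy; apply Fin.ext; simpa using hxy)] at h3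
    have h4 : (Finset.univ.filter fun b : Fin n => cd n a b = m).card ≤ 4 :=
      h3.trans Finset.card_le_four
    exact_mod_cast h4
  refine (Finset.sum_le_sum fun m _ => fib m).trans ?_
  rw [← Finset.mul_sum]
  apply mul_le_mul_of_nonneg_left _ (by norm_num)
  rw [Finset.sum_range_succ']
  have hh := harmonic_le_one_add_log n
  rw [harmonic] at hh
  push_cast at hh
  have : ∑ m ∈ Finset.range n, (1 : ℝ) / (max 1 (m + 1) : ℕ) = ∑ m ∈ Finset.range n, ((m : ℝ) + 1)⁻¹ := by
    apply Finset.sum_congr rfl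
    intro m _
    rw [max_eq_right (by omega)]
    push_cast
    rw [one_div]
  rw [this]
  norm_num
  linarith

/-- The polylogarithmic bound. -/
def LL (n : ℕ) : ℝ := 4 * (2 + Real.log n)

lemma cnorm_k_le (n k : ℕ) (u : Node n k) : cnorm n k u k ≤ LL n ^ k := by
  have h1 : cnorm n k u k ≤ ∑ v : Node n k, ∏ i, (1 : ℝ) / (max 1 (cd n (u i) (v i)) : ℕ) := by
    unfold cnorm
    calc _ ≤ ∑ v ∈ others n k u, ∏ i, (1 : ℝ) / (max 1 (cd n (u i) (v i)) : ℕ) := by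
          apply Finset.sum_le_sum
          intro v hv
          have hd := dM_posR hv
          rw [Real.rpow_neg (by linarith), Real.rpow_natCast, ← one_div, ← one_div_pow]
          calc ((1 : ℝ) / dM n k u v) ^ k = ∏ i : Fin k, (1 : ℝ) / dM n k u v := by simp
            _ ≤ _ := by
              apply Finset.prod_le_prod
              · intros; positivity
              · intro i _
                apply one_div_le_one_div_of_le
                · have : 0 < max 1 (cd n (u i) (v i)) := by omega
                  exact_mod_cast this
                · have h2 := cd_le_dM n k u v i
                  have h3 := dM_pos n k u v ((mem_others n k u v).1 hv)
                  exact_mod_cast max_le h3 h2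
      _ ≤ _ := by
          apply Finset.sum_le_sum_of_subset_of_nonneg (Finset.subset_univ _)
          intros; positivity
  refine h1.trans ?_
  rw [← Fintype.prod_sum (fun (i : Fin k) (b : Fin n) => (1 : ℝ) / (max 1 (cd n (u i) b) : ℕ))]
  calc _ ≤ ∏ i : Fin k, LL n := by
        apply Finset.prod_le_prod
        · intros; positivity
        · intro i _; exact coord_sum n (u i)
    _ = _ := by simp

lemma LL_ge (n : ℕ) : 1 ≤ LL n := by
  have := Real.log_natCast_nonneg n
  unfold LL; linarith

lemma eventually_small (C η : ℝ) (m : ℕ) (hη : 0 < η) :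
    ∃ n0 : ℕ, ∀ n : ℕ, n0 ≤ n → C * LL n ^ m * (n : ℝ) ^ (-η) < 1 := by
  have h1 : Filter.Tendsto (fun x : ℝ => C * (4 * (2 + Real.log x)) ^ m * x ^ (-η))
      Filter.atTop (nhds 0) := by
    have h2 : (fun x : ℝ => (4 * (2 + Real.log x)) ^ m) =o[Filter.atTop] fun x => x ^ η := by
      have h3 : (fun x : ℝ => 4 * (2 + Real.log x)) =O[Filter.atTop] Real.log := by
        apply Asymptotics.IsBigO.const_mul_left
        apply Asymptotics.IsBigO.add _ (Asymptotics.isBigO_refl _ _)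
        exact (Real.isLittleO_const_log_atTop).isBigO
      refine (h3.pow m).trans_isLittleO ?_
      have := isLittleO_log_rpow_rpow_atTop (m : ℝ) hη
      simpa using this
    have h4 := h2.tendsto_div_nhds_zero
    have h5 := h4.const_mul C
    rw [mul_zero] at h5
    refine h5.congr' ?_
    filter_upwards [Filter.eventually_gt_atTop 0] with x hx
    rw [Real.rpow_neg hx.le]
    ring
  have h6 := (h1.comp tendsto_natCast_atTop_atTop).eventually (gt_mem_nhds zero_lt_one)
  obtain ⟨n0, hn0⟩ := Filter.eventually_atTop.1 h6
  exact ⟨n0, fun n hn => hn0 n hn⟩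

end DRB

namespace DRB

lemma dM_update (n k : ℕ) (u : Node n k) (i : Fin k) (a b : Fin n) :
    dM n k (Function.update u i a) (Function.update u i b) = cd n a b := by
  rw [dM_eq, Finset.sum_eq_single i]
  · simp
  · intro j _ hj
    simp [Function.update_of_ne hj, cd]
  · simp

lemma dM_update_self (n k : ℕ) (u : Node n k) (i : Fin k) (b : Fin n) :
    dM n k u (Function.update u i b) = cd n (u i) b := by
  have := dM_update n k u i (u i) b
  rwa [Function.update_eq_self] at this

lemma cd_one (n : ℕ) (a b : Fin n) (h : (b : ℕ) = a + 1) : cd n a b = 1 := by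
  have h1 := b.2
  unfold cd; omega

lemma exists_nbr (n k : ℕ) (hk : 1 ≤ k) (hn : 2 ≤ n) (u : Node n k) :
    ∃ v, dM n k u v = 1 := by
  let i : Fin k := ⟨0, hk⟩
  by_cases h : (u i : ℕ) + 1 < n
  · refine ⟨Function.update u i ⟨u i + 1, h⟩, ?_⟩
    rw [dM_update_self]
    exact cd_one _ _ _ (by simp)
  · have h2 := (u i).2
    refine ⟨Function.update u i ⟨u i - 1, by omega⟩, ?_⟩
    rw [dM_update_self, cd_comm]
    apply cd_one
    simp
    omega

lemma line_closed (n : ℕ) (Q : Fin n → Prop) (h : ∀ a b, cd n a b = 1 → Q a → Q b)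
    (a b : Fin n) (ha : Q a) : Q b := by
  have up : ∀ (m : ℕ) (x y : Fin n), (y : ℕ) = x + m → (Q x ↔ Q y) := by
    intro m
    induction m with
    | zero => intro x y hxy; rw [Fin.ext (by simpa using hxy) (a := y) (b := x)]
    | succ m ih =>
      intro x y hxy
      have hy := y.2
      let z : Fin n := ⟨x + m, by omega⟩
      rw [ih x z rfl]
      have hz : cd n z y = 1 := cd_one _ _ _ (by simp only [z]; omega)
      exact ⟨h _ _ hz, h _ _ (by rw [cd_comm]; exact hz)⟩
  rcases le_total (a : ℕ) b with hab | hab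
  · exact (up (b - a) a b (by omega)).1 ha
  · exact (up (a - b) b a (by omega)).2 ha

lemma grid_closed (n k : ℕ) (Q : Node n k → Prop)
    (h : ∀ u v, dM n k u v = 1 → Q u → Q v) (u v : Node n k) (hu : Q u) : Q v := by
  have step : ∀ (w : Node n k) (i : Fin k) (b : Fin n), Q w → Q (Function.update w i b) := by
    intro w i b hw
    apply line_closed n (fun a => Q (Function.update w i a)) _ (w i) b
    · simpa using hw
    · intro a c hac
      exact h _ _ (by rw [dM_update, hac])
  have main : ∀ S : Finset (Fin k), Q (fun i => if i ∈ S then v i else u i) := by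
    intro S
    induction S using Finset.induction_on with
    | empty => simpa using hu
    | insert a S ha ih =>
      have := step _ a (v a) ih
      convert this using 1
      funext i
      by_cases hi : i = a
      · subst hi; simp
      · simp [hi]
  simpa using main Finset.univ

lemma rpowd_nonneg (n k : ℕ) (u v : Node n k) (s : ℝ) : 0 ≤ (dM n k u v : ℝ) ^ s := by positivity

lemma cnorm_ge_one (n k : ℕ) (hk : 1 ≤ k) (hn : 2 ≤ n) (u : Node n k) (s : ℝ) :
    1 ≤ cnorm n k u s := by
  obtain ⟨v, hv⟩ := exists_nbr n k hk hn u
  have hv' : v ∈ others n k u := by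
    rw [mem_others]; rintro rfl
    simp [dM_eq, cd] at hv
  have := Finset.single_le_sum (f := fun v => (dM n k u v : ℝ) ^ (-s))
    (fun v _ => rpowd_nonneg n k u v _) hv'
  unfold cnorm
  simpa [hv] using this

lemma linkProb_nonneg (n k : ℕ) (u v : Node n k) (s : ℝ) : 0 ≤ linkProb n k u v s := by
  unfold linkProb cnorm; positivity

/-- The dimension constant. -/
def KK (k : ℕ) : ℝ := 2 * (k : ℝ) ^ k

lemma KK_ge (k : ℕ) (hk : 1 ≤ k) : 1 ≤ KK k ∧ (k : ℝ) ≤ KK k ∧ (k : ℝ) ^ k ≤ KK k := by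
  have h1 : (1 : ℝ) ≤ k := by exact_mod_cast hk
  have h2 : (k : ℝ) ≤ (k : ℝ) ^ k := le_self_pow₀ h1 (by omega)
  unfold KK
  refine ⟨by linarith, by linarith, by linarith⟩

/-- General lower bound on power sums. -/
lemma sum_lower (n k : ℕ) (hk : 1 ≤ k) (hn : 2 ≤ n) (u : Node n k) (s : ℝ) (hs0 : 0 ≤ s)
    (hs : s ≤ k) : (n : ℝ) ^ ((k : ℝ) - s) / KK k ≤ ∑ v ∈ others n k u, (dM n k u v : ℝ) ^ (-s) := by
  have hk1 : (1 : ℝ) ≤ k := by exact_mod_cast hk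
  have hn1 : (2 : ℝ) ≤ n := by exact_mod_cast hn
  have hn0 : (0 : ℝ) < n := by linarith
  calc (n : ℝ) ^ ((k : ℝ) - s) / KK k
      = (n : ℝ) ^ k / 2 * ((k : ℝ) ^ (-(k : ℝ)) * (n : ℝ) ^ (-s)) := by
        unfold KK
        rw [sub_eq_add_neg, Real.rpow_add hn0, Real.rpow_natCast, Real.rpow_neg (by linarith : (0:ℝ) ≤ k),
          Real.rpow_natCast]
        field_simp
    _ ≤ (others n k u).card * ((k : ℝ) * n) ^ (-s) := by
        apply mul_le_mul (card_ge n k hk hn u) _ (by positivity) (by positivity)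
        rw [Real.mul_rpow (by linarith) hn0.le]
        apply mul_le_mul_of_nonneg_right _ (by positivity)
        exact Real.rpow_le_rpow_of_exponent_le hk1 (by linarith)
    _ = ∑ v ∈ others n k u, ((k : ℝ) * n) ^ (-s) := by simp
    _ ≤ _ := by
        apply Finset.sum_le_sum
        intro v hv
        exact Real.rpow_le_rpow_of_nonpos (by linarith [dM_posR hv]) (dM_leR n k u v) (by linarith)

lemma link_le (n k : ℕ) (hk : 1 ≤ k) (hn : 2 ≤ n) (u v : Node n k) (hv : v ∈ others n k u)
    (s : ℝ) (hs0 : 0 ≤ s) (hs : s ≤ k) :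
    linkProb n k u v s ≤
      KK k * (dM n k u v : ℝ) ^ (-(k : ℝ)) * ((dM n k u v : ℝ) / n) ^ ((k : ℝ) - s) := by
  have hn1 : (2 : ℝ) ≤ n := by exact_mod_cast hn
  have hn0 : (0 : ℝ) < n := by linarith
  have hd := dM_posR hv
  have hd0 : (0 : ℝ) < dM n k u v := by linarith
  have hK : 0 < KK k := by linarith [(KK_ge k hk).1]
  have h := sum_lower n k hk hn u s hs0 hs
  unfold linkProb
  calc (dM n k u v : ℝ) ^ (-s) / cnorm n k u s
      ≤ (dM n k u v : ℝ) ^ (-s) / ((n : ℝ) ^ ((k : ℝ) - s) / KK k) := by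
        apply div_le_div_of_nonneg_left (by positivity) (by positivity) h
    _ = _ := by
        rw [Real.div_rpow hd0.le hn0.le, show -s = -(k : ℝ) + (k - s) by ring, Real.rpow_add hd0]
        field_simp

lemma dn_le (n k : ℕ) (hn : 2 ≤ n) (u v : Node n k) : (dM n k u v : ℝ) / n ≤ k := by
  have hn1 : (2 : ℝ) ≤ n := by exact_mod_cast hn
  rw [div_le_iff₀ (by linarith)]
  exact dM_leR n k u v

lemma dn_pow_le (n k : ℕ) (hk : 1 ≤ k) (hn : 2 ≤ n) (u v : Node n k) (s : ℝ) (hs0 : 0 ≤ s)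
    (hs : s ≤ k) : ((dM n k u v : ℝ) / n) ^ ((k : ℝ) - s) ≤ KK k := by
  have hk1 : (1 : ℝ) ≤ k := by exact_mod_cast hk
  calc _ ≤ (k : ℝ) ^ ((k : ℝ) - s) :=
        Real.rpow_le_rpow (by positivity) (dn_le n k hn u v) (by linarith)
    _ ≤ (k : ℝ) ^ (k : ℝ) := Real.rpow_le_rpow_of_exponent_le hk1 (by linarith)
    _ ≤ _ := by rw [Real.rpow_natCast]; exact (KK_ge k hk).2.2

lemma link_le_all (n k : ℕ) (hk : 1 ≤ k) (hn : 2 ≤ n) (u v : Node n k) (hv : v ∈ others n k u)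
    (s : ℝ) (hs0 : 0 ≤ s) :
    linkProb n k u v s ≤ KK k ^ 2 * (dM n k u v : ℝ) ^ (-(k : ℝ)) := by
  have hK := (KK_ge k hk).1
  have hd := dM_posR hv
  rcases le_total s k with hs | hs
  · refine (link_le n k hk hn u v hv s hs0 hs).trans ?_
    have := dn_pow_le n k hk hn u v s hs0 hs
    calc _ ≤ KK k * (dM n k u v : ℝ) ^ (-(k : ℝ)) * KK k :=
          mul_le_mul_of_nonneg_left this (by positivity)
      _ = _ := by ring
  · have h1 := cnorm_ge_one n k hk hn u s
    unfold linkProb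
    calc _ ≤ (dM n k u v : ℝ) ^ (-s) := div_le_self (by positivity) h1
      _ ≤ (dM n k u v : ℝ) ^ (-(k : ℝ)) := Real.rpow_le_rpow_of_exponent_le hd (by linarith)
      _ ≤ _ := le_mul_of_one_le_left (by positivity) (one_le_pow₀ hK)

lemma link_split (n k : ℕ) (hk : 1 ≤ k) (hn : 2 ≤ n) (u v : Node n k) (hv : v ∈ others n k u)
    (s r ε γ : ℝ) (hε : 0 ≤ ε) (hγ : 0 ≤ γ) (hs0 : 0 ≤ s) (hs : s ≤ k - γ) (hr : 0 ≤ r) :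
    linkProb n k u v s * linkProb n k v u r ≤
      KK k * (n : ℝ) ^ (-(ε * γ)) * ((dM n k u v : ℝ) ^ (-(k : ℝ)) * linkProb n k v u r)
        + KK k ^ 4 * (n : ℝ) ^ (-(2 * k * (1 - ε))) := by
  have hK := (KK_ge k hk).1
  have hn1 : (2 : ℝ) ≤ n := by exact_mod_cast hn
  have hn0 : (0 : ℝ) < n := by linarith
  have hd := dM_posR hv
  have hd0 : (0 : ℝ) < dM n k u v := by linarith
  have hu : u ∈ others n k v := by
    rw [mem_others] at hv ⊢; exact hv.symm
  have hq0 := linkProb_nonneg n k v u r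
  have hp := link_le n k hk hn u v hv s hs0 (by linarith)
  have hq := link_le_all n k hk hn v u hu r hr
  rw [dM_comm n k v u] at hq
  by_cases hc : (dM n k u v : ℝ) ≤ (n : ℝ) ^ (1 - ε)
  · have h1 : ((dM n k u v : ℝ) / n) ^ ((k : ℝ) - s) ≤ (n : ℝ) ^ (-(ε * γ)) := by
      calc _ ≤ ((n : ℝ) ^ (-ε)) ^ ((k : ℝ) - s) := by
            apply Real.rpow_le_rpow (by positivity) _ (by linarith)
            rw [div_le_iff₀ hn0]
            refine hc.trans (le_of_eq ?_)
            rw [show 1 - ε = -ε + 1 by ring, Real.rpow_add hn0, Real.rpow_one]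
        _ = (n : ℝ) ^ (-ε * ((k : ℝ) - s)) := by rw [Real.rpow_mul hn0.le]
        _ ≤ _ := by
            apply Real.rpow_le_rpow_of_exponent_le (by linarith)
            nlinarith
    have h2 : linkProb n k u v s ≤ KK k * (dM n k u v : ℝ) ^ (-(k : ℝ)) * (n : ℝ) ^ (-(ε * γ)) :=
      hp.trans (mul_le_mul_of_nonneg_left h1 (by positivity))
    have h3 := mul_le_mul_of_nonneg_right h2 hq0
    have h4 : 0 ≤ KK k ^ 4 * (n : ℝ) ^ (-(2 * k * (1 - ε))) := by positivity
    linarith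
  · push Not at hc
    have h1 : (dM n k u v : ℝ) ^ (-(k : ℝ)) ≤ (n : ℝ) ^ (-(k * (1 - ε))) := by
      calc _ ≤ ((n : ℝ) ^ (1 - ε)) ^ (-(k : ℝ)) :=
            Real.rpow_le_rpow_of_nonpos (by positivity) hc.le (by simp)
        _ = _ := by rw [← Real.rpow_mul hn0.le]; congr 1; ring
    have h2 : linkProb n k u v s ≤ KK k * (n : ℝ) ^ (-(k * (1 - ε))) * KK k := by
      refine hp.trans ?_
      gcongr
      exact dn_pow_le n k hk hn u v s hs0 (by linarith)
    have h3 : linkProb n k v u r ≤ KK k ^ 2 * (n : ℝ) ^ (-(k * (1 - ε))) := by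
      refine hq.trans ?_
      gcongr
    have h4 := mul_le_mul h2 h3 hq0 (by positivity)
    have h5 : (n : ℝ) ^ (-(2 * k * (1 - ε))) =
        (n : ℝ) ^ (-(k * (1 - ε))) * (n : ℝ) ^ (-(k * (1 - ε))) := by
      rw [← Real.rpow_add hn0]; congr 1; ring
    rw [h5]
    have h6 : 0 ≤ KK k * (n : ℝ) ^ (-(ε * γ)) *
      ((dM n k u v : ℝ) ^ (-(k : ℝ)) * linkProb n k v u r) := by positivity
    nlinarith

/-- The weighted reciprocity `A = Σ d^{-k} q_v`. -/
def AA (n k : ℕ) (r : Node n k → ℝ) (u : Node n k) : ℝ :=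
  ∑ v ∈ others n k u, (dM n k u v : ℝ) ^ (-(k : ℝ)) * linkProb n k v u (r v)

/-- Payoff as a function of own strategy. -/
def pay (n k : ℕ) (r : Node n k → ℝ) (u : Node n k) (s : ℝ) : ℝ :=
  linkDist n k u s * ∑ v ∈ others n k u, linkProb n k u v s * linkProb n k v u (r v)

lemma payoff_update (n k : ℕ) (r : Node n k → ℝ) (u : Node n k) (s : ℝ) :
    payoff n k (Function.update r u s) u = pay n k r u s := by
  unfold payoff pay recip
  rw [Function.update_self]
  congr 1
  apply Finset.sum_congr rfl
  intro v hv
  rw [Function.update_of_ne ((mem_others n k u v).1 hv)]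

lemma linkDist_eq (n k : ℕ) (u : Node n k) (s : ℝ) :
    linkDist n k u s = (∑ v ∈ others n k u, (dM n k u v : ℝ) ^ (-(s - 1))) / cnorm n k u s := by
  unfold linkDist linkProb
  rw [Finset.sum_div]
  apply Finset.sum_congr rfl
  intro v hv
  have hd := dM_posR hv
  rw [show -(s - 1) = -s + 1 by ring, Real.rpow_add (by linarith), Real.rpow_one]
  ring

lemma recip_eq (n k : ℕ) (r : Node n k → ℝ) (u : Node n k) (s : ℝ) :
    ∑ v ∈ others n k u, linkProb n k u v s * linkProb n k v u (r v) =
    (∑ v ∈ others n k u, (dM n k u v : ℝ) ^ (-s) * linkProb n k v u (r v)) / cnorm n k u s := by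
  rw [Finset.sum_div]
  apply Finset.sum_congr rfl
  intro v hv
  rw [linkProb]
  ring

lemma AA_nonneg (n k : ℕ) (r : Node n k → ℝ) (u : Node n k) : 0 ≤ AA n k r u :=
  Finset.sum_nonneg fun v _ => mul_nonneg (rpowd_nonneg n k u v _) (linkProb_nonneg n k v u _)

/-- Lower bound of the payoff at `s = k`. -/
lemma pay_k (n k : ℕ) (hk : 1 ≤ k) (hn : 2 ≤ n) (r : Node n k → ℝ) (u : Node n k) :
    n / KK k * AA n k r u / (LL n ^ k) ^ 2 ≤ pay n k r u k := by
  have hk1 : (1 : ℝ) ≤ k := by exact_mod_cast hk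
  have hK := (KK_ge k hk).1
  have hA := AA_nonneg n k r u
  have h1 := cnorm_ge_one n k hk hn u k
  have h2 := cnorm_k_le n k u
  unfold pay
  rw [linkDist_eq, recip_eq, div_mul_div_comm, ← sq]
  have h3 := sum_lower n k hk hn u (k - 1) (by linarith) (by linarith)
  rw [show (k : ℝ) - (k - 1) = 1 by ring, Real.rpow_one] at h3
  change _ ≤ _ * AA n k r u / _
  gcongr

lemma cnorm_small (n k : ℕ) (u : Node n k) (γ a : ℝ) (hγ : γ ≤ k) (ha : γ ≤ a) :
    cnorm n k u a ≤ ((k : ℝ) * n) ^ ((k : ℝ) - γ) * LL n ^ k := by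
  calc cnorm n k u a ≤ ∑ v ∈ others n k u, ((k : ℝ) * n) ^ ((k : ℝ) - γ) * (dM n k u v : ℝ) ^ (-(k : ℝ)) := by
        apply Finset.sum_le_sum
        intro v hv
        have hd := dM_posR hv
        calc (dM n k u v : ℝ) ^ (-a) ≤ (dM n k u v : ℝ) ^ (-γ) :=
              Real.rpow_le_rpow_of_exponent_le hd (by linarith)
          _ = (dM n k u v : ℝ) ^ ((k : ℝ) - γ) * (dM n k u v : ℝ) ^ (-(k : ℝ)) := by
              rw [← Real.rpow_add (by linarith)]; congr 1; ring
          _ ≤ _ := by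
              gcongr
              exact dM_leR n k u v
    _ = ((k : ℝ) * n) ^ ((k : ℝ) - γ) * cnorm n k u k := by rw [← Finset.mul_sum]; rfl
    _ ≤ _ := mul_le_mul_of_nonneg_left (cnorm_k_le n k u) (by positivity)

lemma kn_pow_le (n k : ℕ) (hk : 1 ≤ k) (a : ℝ) (ha : a ≤ k) :
    ((k : ℝ) * n) ^ a ≤ KK k * (n : ℝ) ^ a := by
  have hk1 : (1 : ℝ) ≤ k := by exact_mod_cast hk
  rw [Real.mul_rpow (by positivity) (by positivity)]
  gcongr
  calc (k : ℝ) ^ a ≤ (k : ℝ) ^ (k : ℝ) := Real.rpow_le_rpow_of_exponent_le hk1 ha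
    _ ≤ _ := by rw [Real.rpow_natCast]; exact (KK_ge k hk).2.2

lemma pay_hi (n k : ℕ) (hk : 1 ≤ k) (hn : 2 ≤ n) (r : Node n k → ℝ) (u : Node n k) (s γ : ℝ)
    (hγ0 : 0 ≤ γ) (hγ : γ ≤ 1) (hs : k + γ ≤ s) :
    pay n k r u s ≤ KK k * (n : ℝ) ^ (1 - γ) * LL n ^ k * AA n k r u := by
  have hk1 : (1 : ℝ) ≤ k := by exact_mod_cast hk
  have h1 := cnorm_ge_one n k hk hn u s
  have hL := LL_ge n
  have hK := (KK_ge k hk).1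
  unfold pay
  rw [linkDist_eq, recip_eq]
  have h2 : ∑ v ∈ others n k u, (dM n k u v : ℝ) ^ (-(s - 1)) ≤ KK k * (n : ℝ) ^ (1 - γ) * LL n ^ k := by
    have := cnorm_small n k u (k + γ - 1) (s - 1) (by linarith) (by linarith)
    refine this.trans ?_
    have h3 := kn_pow_le n k hk ((k : ℝ) - (k + γ - 1)) (by linarith)
    rw [show (k : ℝ) - (k + γ - 1) = 1 - γ by ring] at h3 ⊢
    gcongr
  have h4 : ∑ v ∈ others n k u, (dM n k u v : ℝ) ^ (-s) * linkProb n k v u (r v) ≤ AA n k r u := by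
    apply Finset.sum_le_sum
    intro v hv
    have hd := dM_posR hv
    apply mul_le_mul_of_nonneg_right _ (linkProb_nonneg n k v u _)
    exact Real.rpow_le_rpow_of_exponent_le hd (by linarith)
  have h5 : 0 ≤ ∑ v ∈ others n k u, (dM n k u v : ℝ) ^ (-s) * linkProb n k v u (r v) :=
    Finset.sum_nonneg fun v _ => mul_nonneg (rpowd_nonneg n k u v _) (linkProb_nonneg n k v u _)
  have h6 : 0 ≤ ∑ v ∈ others n k u, (dM n k u v : ℝ) ^ (-(s - 1)) :=
    Finset.sum_nonneg fun v _ => (rpowd_nonneg n k u v _)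
  apply mul_le_mul ((div_le_self h6 h1).trans h2) ((div_le_self h5 h1).trans h4) (by positivity) (by positivity)

lemma AA_lower (n k : ℕ) (hk : 1 ≤ k) (hn : 2 ≤ n) (r : Node n k → ℝ) (u v : Node n k)
    (hv : dM n k u v = 1) (γ : ℝ) (hγ : γ ≤ k) (hγ0 : 0 ≤ γ) (hr : γ ≤ r v) :
    1 ≤ AA n k r u * (KK k * (n : ℝ) ^ ((k : ℝ) - γ) * LL n ^ k) := by
  have hL := LL_ge n
  have hK := (KK_ge k hk).1
  have hv' : v ∈ others n k u := by
    rw [mem_others]; rintro rfl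
    simp [dM_eq, cd] at hv
  have h1 := Finset.single_le_sum
    (f := fun v => (dM n k u v : ℝ) ^ (-(k : ℝ)) * linkProb n k v u (r v))
    (fun v _ => mul_nonneg (rpowd_nonneg n k u v _) (linkProb_nonneg n k v u _)) hv'
  have h2 : 1 / cnorm n k v (r v) ≤ AA n k r u := by
    refine le_trans (le_of_eq ?_) h1
    simp only [linkProb, dM_comm n k v u, hv]
    simp
  have h3 := cnorm_ge_one n k hk hn v (r v)
  have h4 := cnorm_small n k v γ (r v) hγ hr
  have h5 := kn_pow_le n k hk ((k : ℝ) - γ) (by linarith)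
  have h6 : cnorm n k v (r v) ≤ KK k * (n : ℝ) ^ ((k : ℝ) - γ) * LL n ^ k := by
    refine h4.trans ?_
    gcongr
  rw [div_le_iff₀ (by linarith)] at h2
  exact h2.trans (mul_le_mul_of_nonneg_left h6 (AA_nonneg n k r u))

lemma linkDist_le (n k : ℕ) (hk : 1 ≤ k) (hn : 2 ≤ n) (u : Node n k) (s : ℝ) :
    linkDist n k u s ≤ k * n := by
  have h1 := cnorm_ge_one n k hk hn u s
  calc linkDist n k u s ≤ ∑ v ∈ others n k u, linkProb n k u v s * (k * n) := by
        apply Finset.sum_le_sum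
        intro v _
        exact mul_le_mul_of_nonneg_left (dM_leR n k u v) (linkProb_nonneg n k u v s)
    _ = k * n := by
        rw [← Finset.sum_mul]
        unfold linkProb
        rw [← Finset.sum_div]
        change cnorm n k u s / cnorm n k u s * _ = _
        rw [div_self (by linarith), one_mul]

lemma pay_lo (n k : ℕ) (hk : 1 ≤ k) (hn : 2 ≤ n) (r : Node n k → ℝ) (hr : ∀ v, 0 ≤ r v)
    (u v : Node n k) (hv : dM n k u v = 1) (s γ ε : ℝ) (hε : 0 ≤ ε)
    (hγ0 : 0 ≤ γ) (hγ : γ ≤ 1) (hs0 : 0 ≤ s) (hs : s ≤ k - γ) (hrv : γ ≤ r v) :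
    pay n k r u s ≤ k * n * (KK k * (n : ℝ) ^ (-(ε * γ)) * AA n k r u +
      KK k ^ 5 * LL n ^ k * (n : ℝ) ^ (2 * k * ε - γ) * AA n k r u) := by
  have hk1 : (1 : ℝ) ≤ k := by exact_mod_cast hk
  have hK := (KK_ge k hk).1
  have hn1 : (2 : ℝ) ≤ n := by exact_mod_cast hn
  have hn0 : (0 : ℝ) < n := by linarith
  unfold pay
  apply mul_le_mul (linkDist_le n k hk hn u s) _ _ (by positivity)
  · calc _ ≤ ∑ v ∈ others n k u,
        (KK k * (n : ℝ) ^ (-(ε * γ)) * ((dM n k u v : ℝ) ^ (-(k : ℝ)) * linkProb n k v u (r v))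
        + KK k ^ 4 * (n : ℝ) ^ (-(2 * k * (1 - ε)))) :=
          Finset.sum_le_sum fun v hv => link_split n k hk hn u v hv s (r v) ε γ hε hγ0 hs0 hs (hr v)
      _ = KK k * (n : ℝ) ^ (-(ε * γ)) * AA n k r u +
          (others n k u).card * (KK k ^ 4 * (n : ℝ) ^ (-(2 * k * (1 - ε)))) := by
          rw [Finset.sum_add_distrib, ← Finset.mul_sum]
          simp [AA]
      _ ≤ _ := by
          refine add_le_add le_rfl ?_
          have h1 : ((others n k u).card : ℝ) ≤ (n : ℝ) ^ (k : ℝ) := by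
            rw [card_others, Real.rpow_natCast]; linarith
          have h2 := AA_lower n k hk hn r u v hv γ (by linarith) hγ0 hrv
          calc _ ≤ (n : ℝ) ^ (k : ℝ) * (KK k ^ 4 * (n : ℝ) ^ (-(2 * k * (1 - ε)))) * 1 := by
                rw [mul_one]; gcongr
            _ ≤ (n : ℝ) ^ (k : ℝ) * (KK k ^ 4 * (n : ℝ) ^ (-(2 * k * (1 - ε)))) *
                (AA n k r u * (KK k * (n : ℝ) ^ ((k : ℝ) - γ) * LL n ^ k)) := by
                gcongr
            _ = KK k ^ 5 * LL n ^ k * ((n : ℝ) ^ (k : ℝ) * (n : ℝ) ^ (-(2 * k * (1 - ε))) *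
                (n : ℝ) ^ ((k : ℝ) - γ)) * AA n k r u := by ring
            _ = _ := by
                rw [← Real.rpow_add hn0, ← Real.rpow_add hn0]
                rw [show (k : ℝ) + -(2 * k * (1 - ε)) + (k - γ) = 2 * k * ε - γ by ring]
  · exact Finset.sum_nonneg fun v _ => mul_nonneg (linkProb_nonneg n k u v _) (linkProb_nonneg n k v u _)

/-- The key best-response lemma. -/
lemma key (k g : ℕ) (hk : 1 ≤ k) (hg : 2 ≤ g) : ∃ n0 : ℕ, ∀ n : ℕ, n0 ≤ n → 2 ≤ n ∧
    ∀ (r : Node n k → ℝ) (_ : ValidProfile n k (g : ℝ)⁻¹ r) (u v : Node n k),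
      dM n k u v = 1 → 0 < r v → r u ≠ k → pay n k r u (r u) < pay n k r u k := by
  have hk1 : (1 : ℝ) ≤ k := by exact_mod_cast hk
  have hg1 : (2 : ℝ) ≤ g := by exact_mod_cast hg
  obtain ⟨γ, hγ⟩ : ∃ γ : ℝ, γ = (g : ℝ)⁻¹ := ⟨_, rfl⟩
  have hγ0 : 0 < γ := by rw [hγ]; positivity
  have hgγ : g * γ = 1 := by rw [hγ]; field_simp
  have hγ1 : γ ≤ 1 := by nlinarith
  obtain ⟨ε, hε⟩ : ∃ ε : ℝ, ε = γ / (4 * k) := ⟨_, rfl⟩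
  have hε0 : 0 < ε := by rw [hε]; positivity
  have hkε : 2 * k * ε - γ = -(γ / 2) := by rw [hε]; field_simp; ring
  have hε1 : ε ≤ 1 / 2 := by nlinarith
  have hη : 0 < ε * γ := by positivity
  have hηγ : ε * γ ≤ γ / 2 := by nlinarith
  have hK := (KK_ge k hk).1
  have hKk := (KK_ge k hk).2.1
  obtain ⟨n1, hn1⟩ := eventually_small (2 * KK k ^ 7) (ε * γ) (3 * k) hη
  refine ⟨max 2 n1, fun n hn => ⟨le_of_max_le_left hn, ?_⟩⟩
  have hn2 : 2 ≤ n := le_of_max_le_left hn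
  have hsm := hn1 n (le_of_max_le_right hn)
  intro r hr u v huv hv hu
  rw [← hγ] at hr
  have hnR : (2 : ℝ) ≤ n := by exact_mod_cast hn2
  have hn0 : (0 : ℝ) < n := by linarith
  have hL := LL_ge n
  have hr0 : ∀ v, 0 ≤ r v := by
    intro v; obtain ⟨m, hm⟩ := hr v; rw [hm]; positivity
  have hrv : γ ≤ r v := by
    obtain ⟨m, hm⟩ := hr v
    have : m ≠ 0 := by rintro rfl; simp [hm] at hv
    have : (1 : ℝ) ≤ m := by exact_mod_cast Nat.one_le_iff_ne_zero.2 this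
    rw [hm]; nlinarith
  have hA : 0 < AA n k r u := by
    have h1 := AA_lower n k hk hn2 r u v huv γ (by linarith) hγ0.le hrv
    have h2 := AA_nonneg n k r u
    rcases h2.eq_or_lt with h | h
    · rw [← h] at h1; norm_num at h1
    · exact h
  refine lt_of_lt_of_le ?_ (pay_k n k hk hn2 r u)
  have hX : pay n k r u (r u) ≤ n * AA n k r u * (2 * KK k ^ 6 * LL n ^ k * (n : ℝ) ^ (-(ε * γ))) := by
    obtain ⟨m, hm⟩ := hr u
    rcases lt_trichotomy m (k * g) with h | h | h
    · have h1 : (m : ℝ) + 1 ≤ k * g := by exact_mod_cast h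
      have h2 : r u ≤ k - γ := by
        rw [hm]
        have := mul_le_mul_of_nonneg_right h1 hγ0.le
        rw [mul_assoc, hgγ] at this; linarith
      have h3 := pay_lo n k hk hn2 r hr0 u v huv (r u) γ ε hε0.le hγ0.le hγ1 (hr0 u) h2 hrv
      rw [hkε] at h3
      refine h3.trans ?_
      have h4 : (n : ℝ) ^ (-(γ / 2)) ≤ (n : ℝ) ^ (-(ε * γ)) :=
        Real.rpow_le_rpow_of_exponent_le (by linarith) (by linarith)
      have h5 : KK k ≤ KK k ^ 5 * LL n ^ k := by
        calc KK k ≤ KK k ^ 5 := le_self_pow₀ hK (by norm_num)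
          _ ≤ _ := le_mul_of_one_le_right (by positivity) (one_le_pow₀ hL)
      calc _ ≤ KK k * n * (KK k ^ 5 * LL n ^ k * (n : ℝ) ^ (-(ε * γ)) * AA n k r u +
            KK k ^ 5 * LL n ^ k * (n : ℝ) ^ (-(ε * γ)) * AA n k r u) := by gcongr
        _ = _ := by ring
    · exfalso; apply hu; rw [hm, h]; push_cast; rw [mul_assoc, hgγ, mul_one]
    · have h1 : (k : ℝ) * g + 1 ≤ m := by exact_mod_cast h
      have h2 : k + γ ≤ r u := by
        rw [hm]
        have := mul_le_mul_of_nonneg_right h1 hγ0.le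
        rw [add_mul, mul_assoc, hgγ] at this; linarith
      have h3 := pay_hi n k hk hn2 r u (r u) γ hγ0.le hγ1 h2
      refine h3.trans ?_
      have h4 : (n : ℝ) ^ (1 - γ) ≤ n * (n : ℝ) ^ (-(ε * γ)) := by
        nth_rewrite 2 [← Real.rpow_one (n : ℝ)]
        rw [← Real.rpow_add hn0]
        exact Real.rpow_le_rpow_of_exponent_le (by linarith) (by linarith)
      have h5 : KK k ≤ 2 * KK k ^ 6 := by
        have : KK k ≤ KK k ^ 6 := le_self_pow₀ hK (by norm_num)
        linarith
      calc _ ≤ 2 * KK k ^ 6 * (n * (n : ℝ) ^ (-(ε * γ))) * LL n ^ k * AA n k r u := by gcongr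
        _ = _ := by ring
  refine hX.trans_lt ?_
  rw [lt_div_iff₀ (by positivity), div_mul_eq_mul_div, lt_div_iff₀ (by positivity)]
  have h7 : 0 < (n : ℝ) * AA n k r u := by positivity
  calc _ = (n : ℝ) * AA n k r u * (2 * KK k ^ 7 * LL n ^ (3 * k) * (n : ℝ) ^ (-(ε * γ))) := by ring
    _ < (n : ℝ) * AA n k r u * 1 := mul_lt_mul_of_pos_left hsm h7
    _ = _ := by ring

end DRB

/-- For sufficiently large `n`, no non-uniform strategy profile is a
Nash equilibrium: if `r_u ≠ r_v` for some nodes `u, v`, then some node can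
strictly increase its payoff by a unilateral deviation inside `Σ`. -/
theorem no_nonuniform_equilibrium (k g : ℕ) (hk : 1 ≤ k) (hg : 2 ≤ g) :
    ∃ n0 : ℕ, ∀ n : ℕ, n0 ≤ n →
      ∀ r : DRB.Node n k → ℝ, DRB.ValidProfile n k (g : ℝ)⁻¹ r →
        (∃ u v : DRB.Node n k, r u ≠ r v) →
        ∃ (w : DRB.Node n k) (s : ℝ), DRB.InSigma (g : ℝ)⁻¹ s ∧
          DRB.payoff n k (Function.update r w s) w > DRB.payoff n k r w := by
  obtain ⟨n0, hn0⟩ := DRB.key k g hk hg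
  refine ⟨n0, fun n hn r hr hne => ?_⟩
  obtain ⟨hn2, hkey⟩ := hn0 n hn
  by_contra hcon
  have hkR : (0 : ℝ) < k := by exact_mod_cast hk
  have hgR : (g : ℝ) ≠ 0 := by
    have : g ≠ 0 := by omega
    exact_mod_cast this
  have hr0 : ∀ v, 0 ≤ r v := by
    intro v; obtain ⟨m, hm⟩ := hr v; rw [hm]; positivity
  -- every neighbour of a positive node plays `k`
  have nb : ∀ u v, DRB.dM n k u v = 1 → 0 < r v → r u = k := by
    intro u v huv hv
    by_contra hu
    apply hcon
    refine ⟨u, k, ⟨k * g, by push_cast; field_simp⟩, ?_⟩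
    have h1 := hkey r hr u v huv hv hu
    have h2 : DRB.payoff n k r u = DRB.pay n k r u (r u) := by
      rw [← DRB.payoff_update, Function.update_eq_self]
    rw [DRB.payoff_update, h2]
    exact h1
  obtain ⟨a, b, hab⟩ := hne
  have hpos : ∃ c, 0 < r c := by
    by_contra hno
    push Not at hno
    exact hab (le_antisymm ((hno a).trans (hr0 b)) ((hno b).trans (hr0 a)))
  obtain ⟨c, hc⟩ := hpos
  have all : ∀ v, 0 < r v := fun v =>
    DRB.grid_closed n k (fun v => 0 < r v) (fun x y hxy hx => by
      have := nb y x (by rw [DRB.dM_comm]; exact hxy) hx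
      simp only [this, hkR]) c v hc
  have allk : ∀ u, r u = k := by
    intro u
    obtain ⟨v, hv⟩ := DRB.exists_nbr n k hk hn2 u
    exact nb u v hv (all v)
  exact hab ((allk a).trans (allk b).symm)
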